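/- The rate function I(x) = h_x(z(x)) is strictly increasing on (0,1). -/

import Mathlib

/-- The function `h_x(z) = ln z - x ln(1-(1-z)^α)` for `z ∈ (0,1)`. -/
noncomputable def hfun (α x : ℝ) : ℝ → ℝ :=
  fun z => Real.log z - x * Real.log (1 - (1 - z) ^ α)

/-- The rate function `I(x) = h_x(z(x))`, where `zf` is the saddle-point map. -/
noncomputable def Ifun (α : ℝ) (zf : ℝ → ℝ) : ℝ → ℝ :=
  fun x => hfun α x (zf x)

lemma one_sub_rpow_mem_Ioo {α z : ℝ} (hα : 0 < α) (hz : z ∈ Set.Ioo (0 : ℝ) 1) :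
    1 - (1 - z) ^ α ∈ Set.Ioo (0 : ℝ) 1 := by
  have h0 : 0 < (1 - z) ^ α := Real.rpow_pos_of_pos (by linarith [hz.2]) α
  have h1 : (1 - z) ^ α < 1 := Real.rpow_lt_one (by linarith [hz.2]) (by linarith [hz.1]) hα
  exact ⟨by linarith, by linarith⟩

/-- The sign of `h_x'(z)` is that of the function `w ↦ w^(1-α) - w - x α (1-w)`, concave in
`w = 1 - z`. -/
lemma hasDerivAt_hfun {α z : ℝ} (x : ℝ) (hα : 0 < α) (hz : z ∈ Set.Ioo (0 : ℝ) 1) :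
    HasDerivAt (hfun α x)
      (((1 - z) ^ (1 - α) - (1 - z) - x * α * z) /
        (z * (1 - z) ^ (1 - α) * (1 - (1 - z) ^ α))) z := by
  have hw : 0 < 1 - z := by linarith [hz.2]
  have hz0 : z ≠ 0 := hz.1.ne'
  have hq : 1 - (1 - z) ^ α ≠ 0 := (one_sub_rpow_mem_Ioo hα hz).1.ne'
  have hd : HasDerivAt (fun y : ℝ => 1 - (1 - y) ^ α) (α * (1 - z) ^ (α - 1)) z := by
    have h := (((hasDerivAt_id z).const_sub 1).rpow_const (p := α) (Or.inl hw.ne')).const_sub 1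
    exact h.congr_deriv (by simp)
  have h := (Real.hasDerivAt_log hz0).sub ((hd.log hq).const_mul x)
  have hβ : (1 - z) ^ (1 - α) ≠ 0 := (Real.rpow_pos_of_pos hw _).ne'
  have hmul : (1 - z) ^ α * (1 - z) ^ (1 - α) = 1 - z := by
    rw [← Real.rpow_add hw]; simp
  have hinv : (1 - z) ^ (α - 1) = ((1 - z) ^ (1 - α))⁻¹ := by
    rw [← Real.rpow_neg hw.le]; ring_nf
  refine h.congr_deriv ?_
  rw [hinv]
  generalize (1 - z) ^ (1 - α) = b at *
  generalize (1 - z) ^ α = a at *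
  field_simp
  linear_combination (-1 : ℝ) * hmul

lemma concaveOn_saddle {α : ℝ} (x : ℝ) (hα : α ∈ Set.Ioo (0 : ℝ) 1) :
    ConcaveOn ℝ (Set.Icc (0 : ℝ) 1)
      (fun z : ℝ => (1 - z) ^ (1 - α) - (1 - z) - x * α * z) := by
  have hc := Real.concaveOn_rpow (p := 1 - α) (by linarith [hα.2]) (by linarith [hα.1])
  refine ⟨convex_Icc 0 1, fun u hu v hv a b ha hb hab => ?_⟩
  have h := hc.2 (x := 1 - u) (y := 1 - v) (by simpa using hu.2) (by simpa using hv.2) ha hb hab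
  have he : 1 - (a * u + b * v) = a * (1 - u) + b * (1 - v) := by linear_combination -hab
  simp only [smul_eq_mul] at h ⊢
  rw [he]
  linarith

/-- A critical point of `h_x` in `(0,1)` is a global maximum there. -/
lemma hfun_le_of_deriv_eq_zero {α x c z : ℝ} (hα : α ∈ Set.Ioo (0 : ℝ) 1)
    (hc : c ∈ Set.Ioo (0 : ℝ) 1) (hcrit : deriv (hfun α x) c = 0)
    (hz : z ∈ Set.Ioo (0 : ℝ) 1) : hfun α x z ≤ hfun α x c := by
  have hden : ∀ y ∈ Set.Ioo (0 : ℝ) 1, 0 < y * (1 - y) ^ (1 - α) * (1 - (1 - y) ^ α) :=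
    fun y hy => mul_pos (mul_pos hy.1 (Real.rpow_pos_of_pos (by linarith [hy.2]) _))
      (one_sub_rpow_mem_Ioo hα.1 hy).1
  have hcont : ContinuousOn (hfun α x) (Set.Ioo 0 1) :=
    fun y hy => (hasDerivAt_hfun x hα.1 hy).continuousAt.continuousWithinAt
  have hdiff : DifferentiableOn ℝ (hfun α x) (Set.Ioo 0 1) :=
    fun y hy => (hasDerivAt_hfun x hα.1 hy).differentiableAt.differentiableWithinAt
  have hPc : (1 - c) ^ (1 - α) - (1 - c) - x * α * c = 0 := by
    rw [(hasDerivAt_hfun x hα.1 hc).deriv, div_eq_zero_iff] at hcrit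
    exact hcrit.resolve_right (hden c hc).ne'
  have hP := (concaveOn_saddle x hα).2
  have hP0 : (1 - (0 : ℝ)) ^ (1 - α) - (1 - 0) - x * α * 0 = 0 := by simp
  rcases le_total z c with hle | hle
  · have hsub : Set.Icc z c ⊆ Set.Ioo 0 1 := Set.Icc_subset_Ioo hz.1 hc.2
    refine monotoneOn_of_deriv_nonneg (convex_Icc z c) (hcont.mono hsub)
      (hdiff.mono (interior_subset.trans hsub)) (fun y hy => ?_)
      (Set.left_mem_Icc.2 hle) (Set.right_mem_Icc.2 hle) hle
    have hy' := interior_subset hy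
    rw [(hasDerivAt_hfun x hα.1 (hsub hy')).deriv]
    refine div_nonneg ?_ (hden y (hsub hy')).le
    have h := hP (x := 0) (y := c) ⟨le_rfl, zero_le_one⟩ ⟨hc.1.le, hc.2.le⟩
      (a := 1 - y / c) (b := y / c) (sub_nonneg.2 ((div_le_one hc.1).2 hy'.2))
      (div_nonneg (hsub hy').1.le hc.1.le) (by ring)
    simp only [smul_eq_mul] at h
    rw [hP0, hPc, mul_zero, mul_zero, add_zero, zero_add, div_mul_cancel₀ y hc.1.ne'] at h
    exact h
  · have hsub : Set.Icc c z ⊆ Set.Ioo 0 1 := Set.Icc_subset_Ioo hc.1 hz.2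
    refine antitoneOn_of_deriv_nonpos (convex_Icc c z) (hcont.mono hsub)
      (hdiff.mono (interior_subset.trans hsub)) (fun y hy => ?_)
      (Set.left_mem_Icc.2 hle) (Set.right_mem_Icc.2 hle) hle
    have hy' := interior_subset hy
    have hyI := hsub hy'
    rw [(hasDerivAt_hfun x hα.1 hyI).deriv]
    refine div_nonpos_of_nonpos_of_nonneg ?_ (hden y hyI).le
    have h := hP (x := 0) (y := y) ⟨le_rfl, zero_le_one⟩ ⟨hyI.1.le, hyI.2.le⟩
      (a := 1 - c / y) (b := c / y) (sub_nonneg.2 ((div_le_one hyI.1).2 hy'.1))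
      (div_nonneg hc.1.le hyI.1.le) (by ring)
    simp only [smul_eq_mul] at h
    rw [hP0, mul_zero, zero_add, zero_add, div_mul_cancel₀ c hyI.1.ne', hPc] at h
    exact nonpos_of_mul_nonpos_right h (div_pos hc.1 hyI.1)

lemma hfun_lt_hfun {α x y z : ℝ} (hα : 0 < α) (hz : z ∈ Set.Ioo (0 : ℝ) 1) (hxy : x < y) :
    hfun α x z < hfun α y z := by
  have hq := one_sub_rpow_mem_Ioo hα hz
  exact sub_lt_sub_left (mul_lt_mul_of_neg_right hxy (Real.log_neg hq.1 hq.2)) _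


/-- the rate function `I(x) = h_x(z(x))` is strictly increasing
on `(0,1)`. -/
theorem rate_function_strictMono (α : ℝ) (hα : α ∈ Set.Ioo (0 : ℝ) 1)
    (zf : ℝ → ℝ)
    (hzf : ∀ x ∈ Set.Ioo (0 : ℝ) 1, zf x ∈ Set.Ioo (0 : ℝ) 1 ∧
      deriv (hfun α x) (zf x) = 0) :
    StrictMonoOn (Ifun α zf) (Set.Ioo (0 : ℝ) 1) := by
  intro x hx y hy hxy
  obtain ⟨hzx, -⟩ := hzf x hx
  obtain ⟨hzy, hcrit⟩ := hzf y hy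
  exact (hfun_lt_hfun hα.1 hzx hxy).trans_le (hfun_le_of_deriv_eq_zero hα hzy hcrit hzx)
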